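/- Let p > 1, T > 0, a > 0 and b ≥ 0. Then λ_p^{a,b}(-T,T) = ((a+b)/2)^p · λ_{1,p}(-T,T). -/

import Mathlib

open MeasureTheory Filter Set
open scoped Topology RealInnerProductSpace

noncomputable section

/-- Positive part. -/
def ppart (t : ℝ) : ℝ := max t 0
/-- Negative part. -/
def npart (t : ℝ) : ℝ := max (-t) 0

/-- `u ∈ W^{1,p}(α,β)` (continuous representative on `[α,β]`), with weak derivative `u'`. -/
def MemW1pC (p α β : ℝ) (u u' : ℝ → ℝ) : Prop :=
  IntervalIntegrable u' volume α β ∧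
  (∀ t ∈ Set.Icc α β, u t = u α + ∫ s in α..t, u' s) ∧
  IntegrableOn (fun t => |u' t| ^ p) (Set.Ioo α β) volume

/-- `u ∈ W^{1,p}_0(α,β)`, with weak derivative `u'`. -/
def MemW1p0 (p α β : ℝ) (u u' : ℝ → ℝ) : Prop :=
  MemW1pC p α β u u' ∧ u α = 0 ∧ u β = 0

/-- `u ∈ W^{1,p}(α,β)` (interior version: no constraint at endpoints). -/
def MemW1pI (p α β : ℝ) (u u' : ℝ → ℝ) : Prop :=
  IntervalIntegrable u' volume α β ∧
  (∀ s ∈ Set.Ioo α β, ∀ t ∈ Set.Ioo α β, u t = u s + ∫ r in s..t, u' r) ∧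
  IntegrableOn (fun t => |u' t| ^ p) (Set.Ioo α β) volume

/-- `λ_p^H(α,β)` for a one-dimensional anisotropy `H`. -/
def lamH1 (p : ℝ) (H : ℝ → ℝ) (α β : ℝ) : ℝ :=
  sInf { E | ∃ u u', MemW1p0 p α β u u' ∧ (∫ t in Set.Ioo α β, |u t| ^ p) = 1 ∧
    E = ∫ t in Set.Ioo α β, H (u' t) ^ p }

/-- `λ_{1,p}(α,β)`, the principal Dirichlet eigenvalue of the 1d `p`-Laplacian. -/
def lam1 (p α β : ℝ) : ℝ := lamH1 p (fun t => |t|) α β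

/-- `λ_p^{a,b}(α,β)`. -/
def lamAB (p a b α β : ℝ) : ℝ := lamH1 p (fun t => a * ppart t + b * npart t) α β

/-- `λ_p^+(-T,T)`. -/
def lamPlus (p T : ℝ) : ℝ := lamH1 p ppart (-T) T

/-- `φ` is the (normalized positive) principal eigenfunction of the 1d `p`-Laplacian
on `(-T,T)`, with weak derivative `φ'`. -/
def IsPrincipalEigenfunction (p T : ℝ) (φ φ' : ℝ → ℝ) : Prop :=
  MemW1p0 p (-T) T φ φ' ∧ (∀ t ∈ Set.Ioo (-T) T, 0 < φ t) ∧
  (∫ t in Set.Ioo (-T) T, |φ t| ^ p) = 1 ∧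
  (∫ t in Set.Ioo (-T) T, |φ' t| ^ p) = lam1 p (-T) T

/-- The piecewise Sobolev class `W_pw^{1,p,+}(-T,T)`. -/
def MemWpw (p T : ℝ) (u u' : ℝ → ℝ) : Prop :=
  ∃ (m : ℕ) (P : ℕ → ℝ), 0 < m ∧ P 0 = -T ∧ P m = T ∧
    (∀ i < m, P i < P (i + 1)) ∧
    (∀ i < m, MemW1pI p (P i) (P (i + 1)) u u') ∧
    (∃ l₀, Tendsto u (𝓝[>] (-T)) (𝓝 l₀) ∧ l₀ ≤ 0) ∧
    (∃ l₁, Tendsto u (𝓝[<] T) (𝓝 l₁) ∧ 0 ≤ l₁) ∧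
    (∀ i, 0 < i → i < m → ∃ lm lp, Tendsto u (𝓝[<] (P i)) (𝓝 lm) ∧
      Tendsto u (𝓝[>] (P i)) (𝓝 lp) ∧ lp < lm)

/-! ### Two dimensions -/

/-- The Euclidean plane. -/
abbrev V2 := EuclideanSpace ℝ (Fin 2)

/-- The point of `ℝ²` with coordinates `(x, y)`. -/
def mk2 (x y : ℝ) : V2 := (EuclideanSpace.equiv (Fin 2) ℝ).symm ![x, y]

/-- An asymmetric anisotropy: nonnegative, convex and positively 1-homogeneous. -/
def IsAnisotropy (H : V2 → ℝ) : Prop :=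
  (∀ v, 0 ≤ H v) ∧ ConvexOn ℝ Set.univ H ∧ ∀ t : ℝ, 0 < t → ∀ v : V2, H (t • v) = t * H v

/-- A bounded domain of `ℝ²`. -/
def IsBoundedDomain (Ω : Set V2) : Prop :=
  IsOpen Ω ∧ IsConnected Ω ∧ Bornology.IsBounded Ω

/-- Smooth compactly supported test function on `Ω`. -/
def TestFun2 (Ω : Set V2) (φ : V2 → ℝ) : Prop :=
  ContDiff ℝ (⊤ : ℕ∞) φ ∧ HasCompactSupport φ ∧ tsupport φ ⊆ Ω

/-- `u ∈ W^{1,p}_0(Ω)`, with weak gradient `g`: `u` and `g` are `p`-integrable on `Ω`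
and approximable in `W^{1,p}`-norm by smooth functions compactly supported in `Ω`. -/
def MemW1p02 (p : ℝ) (Ω : Set V2) (u : V2 → ℝ) (g : V2 → V2) : Prop :=
  IntegrableOn (fun x => |u x| ^ p) Ω volume ∧
  IntegrableOn (fun x => ‖g x‖ ^ p) Ω volume ∧
  ∃ φ : ℕ → V2 → ℝ, (∀ n, TestFun2 Ω (φ n)) ∧
    Tendsto (fun n => ∫ x in Ω, |u x - φ n x| ^ p) atTop (𝓝 0) ∧
    Tendsto (fun n => ∫ x in Ω, ‖g x - gradient (φ n) x‖ ^ p) atTop (𝓝 0)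

/-- The least anisotropic energy level `λ_p^H(Ω)`. -/
def lamH (p : ℝ) (H : V2 → ℝ) (Ω : Set V2) : ℝ :=
  sInf { E | ∃ u g, MemW1p02 p Ω u g ∧ (∫ x in Ω, |u x| ^ p) = 1 ∧
    E = ∫ x in Ω, H (g x) ^ p }

/-- `λ_p^H(Ω)` is a fundamental frequency of `-Δ_p^H` on `Ω`. -/
def IsFundFreq (p : ℝ) (H : V2 → ℝ) (Ω : Set V2) : Prop :=
  ∃ u g, MemW1p02 p Ω u g ∧ ¬ (∀ᵐ x ∂(volume.restrict Ω), u x = 0) ∧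
    (∀ᵐ x ∂(volume.restrict Ω), DifferentiableAt ℝ H (g x)) ∧
    AEMeasurable (fun x => gradient H (g x)) (volume.restrict Ω) ∧
    ∀ φ gφ, MemW1p02 p Ω φ gφ →
      (∫ x in Ω, H (g x) ^ (p - 1) * ⟪gradient H (g x), gφ x⟫) =
        lamH p H Ω * ∫ x in Ω, |u x| ^ (p - 2) * u x * φ x

/-- The infimum `λ_p^H(Ω)` is attained by a (normalized, hence nonzero) function. -/
def IsAttained (p : ℝ) (H : V2 → ℝ) (Ω : Set V2) : Prop :=
  ∃ u g, MemW1p02 p Ω u g ∧ (∫ x in Ω, |u x| ^ p) = 1 ∧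
    (∫ x in Ω, H (g x) ^ p) = lamH p H Ω

/-- `‖H‖ := max {H v : |v| = 1}`. -/
def normH (H : V2 → ℝ) : ℝ := sSup (H '' Metric.sphere 0 1)

/-- A rotation: a linear isometry with positive determinant. -/
def IsRotation (A : V2 ≃ₗᵢ[ℝ] V2) : Prop :=
  0 < LinearMap.det (A.toLinearEquiv : V2 →ₗ[ℝ] V2)

/-- The kernel of an anisotropy. -/
def kerH (H : V2 → ℝ) : Set V2 := {v | H v = 0}

/-- `S` is a line through the origin. -/
def IsLine (S : Set V2) : Prop := ∃ v : V2, v ≠ 0 ∧ S = {w | ∃ t : ℝ, w = t • v}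

/-- `S` is a closed half-plane bounded by a line through the origin. -/
def IsClosedHalfPlane (S : Set V2) : Prop := ∃ v : V2, v ≠ 0 ∧ S = {w | ⟪v, w⟫ ≤ 0}

/-- Smooth compactly supported test function on an open set `S ⊆ ℝ`. -/
def TestFun1 (S : Set ℝ) (φ : ℝ → ℝ) : Prop :=
  ContDiff ℝ (⊤ : ℕ∞) φ ∧ HasCompactSupport φ ∧ tsupport φ ⊆ S

/-- `v ∈ W^{1,p}_0(S)` for an open set `S ⊆ ℝ`, with weak derivative `v'`. -/
def MemW1p0S (p : ℝ) (S : Set ℝ) (v v' : ℝ → ℝ) : Prop :=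
  IntegrableOn (fun t => |v t| ^ p) S volume ∧
  IntegrableOn (fun t => |v' t| ^ p) S volume ∧
  ∃ φ : ℕ → ℝ → ℝ, (∀ n, TestFun1 S (φ n)) ∧
    Tendsto (fun n => ∫ t in S, |v t - φ n t| ^ p) atTop (𝓝 0) ∧
    Tendsto (fun n => ∫ t in S, |v' t - deriv (φ n) t| ^ p) atTop (𝓝 0)

/-- A bounded domain with Lipschitz (`C^{0,1}`) boundary: near each boundary point, after a
rigid motion, `Ω` is the region above the graph of a Lipschitz function. -/
def IsC01Domain (Ω : Set V2) : Prop :=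
  IsBoundedDomain Ω ∧
  ∀ z ∈ frontier Ω, ∃ (A : V2 ≃ₗᵢ[ℝ] V2) (r K : ℝ) (f : ℝ → ℝ), 0 < r ∧ 0 ≤ K ∧
    LipschitzWith (Real.toNNReal K) f ∧
    ∀ v ∈ Metric.ball z r, (v ∈ Ω ↔ f ((A (v - z)) 0) < (A (v - z)) 1)

/-- The supremal length of a vertical open segment contained in `D`. -/
def vertWidth (D : Set V2) : ℝ :=
  sSup {l : ℝ | ∃ x c : ℝ, ∀ y ∈ Set.Ioo c (c + l), mk2 x y ∈ D}

/-- The width function `L_θ` of `Ω` in direction `θ`. -/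
def widthFn (Ω : Set V2) (θ : ℝ) : ℝ :=
  sSup {l : ℝ | ∃ (v : V2) (t0 : ℝ),
    ∀ t ∈ Set.Ioo t0 (t0 + l), v + t • mk2 (Real.cos θ) (Real.sin θ) ∈ Ω}

/-- The variational `p`-capacity of `K` relative to `B`. -/
def pCap (p : ℝ) (K B : Set V2) : ℝ :=
  sInf { E | ∃ φ : V2 → ℝ, ContDiff ℝ (⊤ : ℕ∞) φ ∧ HasCompactSupport φ ∧ tsupport φ ⊆ B ∧
    (∀ x ∈ K, 1 ≤ φ x) ∧ E = ∫ x, ‖gradient φ x‖ ^ p }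

/-- The Wiener criterion for the `p`-Laplacian at a boundary point `z`:
the Wiener integral diverges. -/
def WienerRegularAt (p : ℝ) (Ω : Set V2) (z : V2) : Prop :=
  ¬ IntegrableOn (fun t =>
      (pCap p (Metric.closedBall z t \ Ω) (Metric.ball z (2 * t)) /
        pCap p (Metric.closedBall z t) (Metric.ball z (2 * t))) ^ (1 / (p - 1)) / t)
    (Set.Ioo (0 : ℝ) 1) volume

/-- The optimal lower spectral constant `Λ^min(Ω)`. -/
def LambdaMin (p : ℝ) (Ω : Set V2) : ℝ :=
  sInf {lam : ℝ | ∃ H : V2 → ℝ, IsAnisotropy H ∧ normH H = 1 ∧ IsFundFreq p H Ω ∧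
    lam = lamH p H Ω}

end

noncomputable section

/-- The one-sided Hardy-type inequality on `(0,1)` with constant `c`, for the primitive of a
nonnegative function. -/
def HalfHardy (p c : ℝ) : Prop :=
  ∀ g : ℝ → ℝ, (∀ t, 0 ≤ g t) → IntervalIntegrable g volume 0 1 →
    IntervalIntegrable (fun t => g t ^ p) volume 0 1 →
    c * ∫ s in (0 : ℝ)..1, (∫ r in (0 : ℝ)..s, g r) ^ p ≤ ∫ s in (0 : ℝ)..1, g s ^ p

theorem ppart_nonneg (t : ℝ) : 0 ≤ ppart t := le_max_right _ _

theorem npart_nonneg (t : ℝ) : 0 ≤ npart t := le_max_right _ _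

theorem ppart_neg (t : ℝ) : ppart (-t) = npart t := rfl

theorem npart_neg (t : ℝ) : npart (-t) = ppart t := by simp [npart, ppart]

theorem ppart_le_abs (t : ℝ) : ppart t ≤ |t| := max_le (le_abs_self t) (abs_nonneg t)

theorem npart_le_abs (t : ℝ) : npart t ≤ |t| := max_le (neg_le_abs t) (abs_nonneg t)

theorem ppart_add_npart (t : ℝ) : ppart t + npart t = |t| := by
  rcases le_total 0 t with h | h <;> simp [ppart, npart, h, abs_of_nonneg, abs_of_nonpos]

theorem anis_nonneg {a b : ℝ} (ha : 0 ≤ a) (hb : 0 ≤ b) (t : ℝ) :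
    0 ≤ a * ppart t + b * npart t :=
  add_nonneg (mul_nonneg ha (ppart_nonneg t)) (mul_nonneg hb (npart_nonneg t))

theorem abs_rpow_eq_add {p : ℝ} (hp : 0 < p) (x : ℝ) :
    |x| ^ p = max x 0 ^ p + max (-x) 0 ^ p := by
  rcases le_total 0 x with h | h <;>
    simp [h, abs_of_nonneg, abs_of_nonpos, Real.zero_rpow hp.ne']

theorem MemW1pC.continuousOn {p α β : ℝ} {u u' : ℝ → ℝ} (h : MemW1pC p α β u u')
    (hαβ : α ≤ β) : ContinuousOn u (Icc α β) := by
  have h1 := intervalIntegral.continuousOn_primitive_interval' h.1 left_mem_uIcc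
  rw [uIcc_of_le hαβ] at h1
  exact (continuousOn_const.add h1).congr h.2.1

theorem measurableSet_pos {u : ℝ → ℝ} {α β : ℝ} (hu : ContinuousOn u (Icc α β)) :
    MeasurableSet (Ioo α β ∩ {t | 0 < u t}) :=
  ((hu.mono Ioo_subset_Icc_self).isOpen_inter_preimage isOpen_Ioo isOpen_Ioi).measurableSet

/-- The positive part of a primitive vanishing at the left endpoint is dominated by the primitive
of the positive part of the derivative over the set where the function is positive. -/
theorem MemW1pC.max_le_integral {p α β : ℝ} {u u' G : ℝ → ℝ} (h : MemW1pC p α β u u')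
    (hu : u α = 0) (hG : IntervalIntegrable G volume α β) (hG0 : ∀ t, 0 ≤ G t)
    (hGu : ∀ t ∈ Ioo α β, 0 < u t → u' t ≤ G t) {t : ℝ} (ht : t ∈ Icc α β) :
    max (u t) 0 ≤ ∫ s in α..t, G s := by
  have hαβ : α ≤ β := ht.1.trans ht.2
  refine max_le ?_ (intervalIntegral.integral_nonneg ht.1 fun s _ => hG0 s)
  by_cases hut : u t ≤ 0
  · exact hut.trans (intervalIntegral.integral_nonneg ht.1 fun s _ => hG0 s)
  push Not at hut
  have hcont : ContinuousOn u (Icc α t) :=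
    (h.continuousOn hαβ).mono (Icc_subset_Icc_right ht.2)
  have hcpt : IsCompact (Icc α t ∩ u ⁻¹' Iic 0) :=
    isCompact_Icc.of_isClosed_subset (hcont.preimage_isClosed_of_isClosed isClosed_Icc isClosed_Iic)
      inter_subset_left
  obtain ⟨s, ⟨hs, hus⟩, hmax⟩ := hcpt.exists_isGreatest ⟨α, ⟨left_mem_Icc.2 ht.1, hu.le⟩⟩
  have hpos : ∀ r ∈ Ioo s t, 0 < u r := by
    intro r hr
    by_contra hcon
    exact absurd (hmax ⟨⟨hs.1.trans hr.1.le, hr.2.le⟩, not_lt.1 hcon⟩) (not_le.2 hr.1)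
  have sub : ∀ {f : ℝ → ℝ} {x y : ℝ}, IntervalIntegrable f volume α β → x ∈ Icc α β →
      y ∈ Icc α β → IntervalIntegrable f volume x y := by
    intro f x y hf hx hy
    exact hf.mono_set (by rw [uIcc_of_le hαβ]; exact uIcc_subset_Icc hx hy)
  have hsI : s ∈ Icc α β := ⟨hs.1, hs.2.trans ht.2⟩
  have hαI : α ∈ Icc α β := left_mem_Icc.2 hαβ
  have hst : u t - u s = ∫ r in s..t, u' r := by
    rw [h.2.1 t ht, h.2.1 s hsI,
      ← intervalIntegral.integral_add_adjacent_intervals (sub h.1 hαI hsI) (sub h.1 hsI ht)]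
    ring
  have h1 : ∫ r in s..t, u' r ≤ ∫ r in s..t, G r :=
    intervalIntegral.integral_mono_on_of_le_Ioo hs.2 (sub h.1 hsI ht) (sub hG hsI ht)
      fun r hr => hGu r ⟨hs.1.trans_lt hr.1, hr.2.trans_le ht.2⟩ (hpos r hr)
  have h2 := intervalIntegral.integral_add_adjacent_intervals (sub hG hαI hsI) (sub hG hsI ht)
  have h3 : 0 ≤ ∫ r in α..s, G r := intervalIntegral.integral_nonneg hs.1 fun r _ => hG0 r
  have : u s ≤ 0 := hus
  linarith

theorem intervalIntegrable_comp_affine {f : ℝ → ℝ} {c d x y : ℝ} (hc : c ≠ 0)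
    (hf : IntervalIntegrable f volume (d + c * x) (d + c * y)) :
    IntervalIntegrable (fun t => f (d + c * t)) volume x y := by
  have := (hf.comp_add_left d).comp_mul_left (c := c)
  simpa [hc] using this

theorem intervalIntegrable_comp_neg {f : ℝ → ℝ} {T : ℝ}
    (hf : IntervalIntegrable f volume (-T) T) :
    IntervalIntegrable (fun t => f (-t)) volume (-T) T := by
  simpa using (hf.comp_sub_left 0).symm

theorem HalfHardy.scale {p c α L : ℝ} (h : HalfHardy p c) (hL : 0 ≤ L)
    {g : ℝ → ℝ} (hg : ∀ t, 0 ≤ g t) (hgi : IntervalIntegrable g volume α (α + L))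
    (hgp : IntervalIntegrable (fun t => g t ^ p) volume α (α + L)) :
    c * ∫ s in α..α + L, (∫ r in α..s, g r) ^ p ≤ L ^ p * ∫ s in α..α + L, g s ^ p := by
  rcases hL.eq_or_lt with rfl | hL
  · simp
  have key := h (fun x => g (α + L * x)) (fun t => hg _)
    (intervalIntegrable_comp_affine hL.ne' (by simpa using hgi))
    (intervalIntegrable_comp_affine (f := fun t => g t ^ p) hL.ne' (by simpa using hgp))
  simp only [intervalIntegral.integral_comp_add_mul (fun x => g x) hL.ne',
    intervalIntegral.integral_comp_add_mul (fun x => g x ^ p) hL.ne', smul_eq_mul, mul_zero,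
    add_zero, mul_one] at key
  have e : ∀ s ∈ uIcc (0 : ℝ) 1, (L⁻¹ * ∫ x in α..α + L * s, g x) ^ p
      = L⁻¹ ^ p * (∫ x in α..α + L * s, g x) ^ p := by
    intro s hs
    rw [uIcc_of_le zero_le_one] at hs
    refine Real.mul_rpow (by positivity) (intervalIntegral.integral_nonneg ?_ fun r _ => hg r)
    nlinarith [hs.1]
  rw [intervalIntegral.integral_congr e, intervalIntegral.integral_const_mul,
    intervalIntegral.integral_comp_add_mul (fun s => (∫ x in α..s, g x) ^ p) hL.ne'] at key
  simp only [smul_eq_mul, mul_zero, add_zero, mul_one, Real.inv_rpow hL.le] at key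
  have hLp : 0 < L ^ p := Real.rpow_pos_of_pos hL p
  have := mul_le_mul_of_nonneg_left key (mul_pos hL hLp).le
  field_simp at this
  linarith

/-- Lower bound for the energy on an interval adjacent to a zero of the function. -/
theorem HalfHardy.le_integral {p c α β L a κ : ℝ} {u u' Φ : ℝ → ℝ} (hH : HalfHardy p c)
    (hp : 0 < p) (hc : 0 ≤ c) (h : MemW1pC p α β u u') (hu : u α = 0)
    (hL : 0 ≤ L) (hLβ : α + L ≤ β) (hκ : 0 ≤ κ) (hκL : κ * L = a)
    (hΦi : IntervalIntegrable Φ volume α β) (hΦ0 : ∀ t, 0 ≤ Φ t)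
    (hΦ : ∀ t ∈ Ioo α β, 0 < u t → (a * ppart (u' t)) ^ p ≤ Φ t) :
    c * κ ^ p * ∫ t in α..α + L, max (u t) 0 ^ p ≤ ∫ t in α..α + L, Φ t := by
  have hαβ : α ≤ β := by linarith
  have ha : 0 ≤ a := hκL ▸ mul_nonneg hκ hL
  set S := Ioo α β ∩ {t | 0 < u t} with hS
  have hSm : MeasurableSet S := measurableSet_pos (h.continuousOn hαβ)
  set G : ℝ → ℝ := S.indicator (fun t => ppart (u' t)) with hGdef
  have hG0 : ∀ t, 0 ≤ G t := fun t => indicator_nonneg (fun t _ => ppart_nonneg _) t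
  have hGle : ∀ t, G t ≤ |u' t| := fun t =>
    indicator_le' (fun t _ => ppart_le_abs _) (fun t _ => abs_nonneg _) t
  have hpI : IntervalIntegrable (fun t => |u' t| ^ p) volume α β :=
    (intervalIntegrable_iff_integrableOn_Ioo_of_le hαβ).2 h.2.2
  have hGm : AEStronglyMeasurable G (volume.restrict (uIoc α β)) :=
    ((h.1.def'.aestronglyMeasurable.sup aestronglyMeasurable_const)).indicator hSm
  have hGi : IntervalIntegrable G volume α β := by
    refine h.1.abs.mono_fun hGm (ae_of_all _ fun t => ?_)
    simpa [abs_of_nonneg (hG0 t)] using hGle t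
  have hGp : IntervalIntegrable (fun t => G t ^ p) volume α β := by
    refine hpI.mono_fun (hGm.aemeasurable.pow_const p).aestronglyMeasurable
      (ae_of_all _ fun t => ?_)
    simp only [Real.norm_eq_abs]
    rw [abs_of_nonneg (Real.rpow_nonneg (hG0 t) p),
      abs_of_nonneg (Real.rpow_nonneg (abs_nonneg _) p)]
    exact Real.rpow_le_rpow (hG0 t) (hGle t) hp.le
  have hsub : uIcc α (α + L) ⊆ uIcc α β := by
    rw [uIcc_of_le hαβ, uIcc_of_le (by linarith)]
    exact Icc_subset_Icc_right hLβ
  have hmax : ∀ t ∈ Icc α (α + L), max (u t) 0 ≤ ∫ s in α..t, G s := fun t ht =>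
    h.max_le_integral hu hGi hG0 (fun s hs hus => by
      rw [hGdef, indicator_of_mem (show s ∈ S from ⟨hs, hus⟩)]
      exact le_max_left _ _) ⟨ht.1, ht.2.trans hLβ⟩
  have hcu : ContinuousOn u (uIcc α (α + L)) := by
    refine (h.continuousOn hαβ).mono ?_
    rwa [uIcc_of_le hαβ] at hsub
  have hcG : ContinuousOn (fun t => ∫ s in α..t, G s) (uIcc α (α + L)) :=
    intervalIntegral.continuousOn_primitive_interval' (hGi.mono_set hsub) left_mem_uIcc
  have h1 : ∫ t in α..α + L, max (u t) 0 ^ p ≤ ∫ t in α..α + L, (∫ s in α..t, G s) ^ p := by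
    refine intervalIntegral.integral_mono_on (by linarith) ?_ ?_ fun t ht =>
      Real.rpow_le_rpow (le_max_right _ _) (hmax t ht) hp.le
    · exact ((hcu.sup continuousOn_const).rpow_const fun _ _ => Or.inr hp.le).intervalIntegrable
    · exact (hcG.rpow_const fun _ _ => Or.inr hp.le).intervalIntegrable
  have h2 := hH.scale hL hG0 (hGi.mono_set hsub) (hGp.mono_set hsub)
  have h3 : a ^ p * ∫ t in α..α + L, G t ^ p ≤ ∫ t in α..α + L, Φ t := by
    rw [← intervalIntegral.integral_const_mul]
    refine intervalIntegral.integral_mono_on_of_le_Ioo (by linarith)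
      ((hGp.mono_set hsub).const_mul _) (hΦi.mono_set hsub) fun t ht => ?_
    rw [← Real.mul_rpow ha (hG0 t)]
    by_cases hut : 0 < u t
    · have htI : t ∈ Ioo α β := ⟨ht.1, ht.2.trans_le hLβ⟩
      rw [hGdef, indicator_of_mem (show t ∈ S from ⟨htI, hut⟩)]
      exact hΦ t htI hut
    · rw [hGdef, indicator_of_notMem (fun hS => hut hS.2), mul_zero, Real.zero_rpow hp.ne']
      exact hΦ0 t
  have hκp : 0 ≤ κ ^ p := Real.rpow_nonneg hκ p
  calc c * κ ^ p * ∫ t in α..α + L, max (u t) 0 ^ p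
      ≤ c * κ ^ p * ∫ t in α..α + L, (∫ s in α..t, G s) ^ p := by gcongr
    _ = κ ^ p * (c * ∫ t in α..α + L, (∫ s in α..t, G s) ^ p) := by ring
    _ ≤ κ ^ p * (L ^ p * ∫ t in α..α + L, G t ^ p) := by gcongr
    _ = a ^ p * ∫ t in α..α + L, G t ^ p := by
      rw [← mul_assoc, ← Real.mul_rpow hκ hL, hκL]
    _ ≤ _ := h3

theorem MemW1p0.neg {p α β : ℝ} {u u' : ℝ → ℝ} (h : MemW1p0 p α β u u') :
    MemW1p0 p α β (fun t => -u t) (fun t => -u' t) := by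
  refine ⟨⟨h.1.1.neg, fun t ht => ?_, by simpa using h.1.2.2⟩, by simp [h.2.1], by simp [h.2.2]⟩
  simp only [intervalIntegral.integral_neg]
  rw [h.1.2.1 t ht]
  ring

theorem MemW1p0.reflect {p T : ℝ} {u u' : ℝ → ℝ} (hT : 0 < T) (h : MemW1p0 p (-T) T u u') :
    MemW1p0 p (-T) T (fun t => u (-t)) (fun t => -u' (-t)) := by
  have hTT : -T ≤ T := by linarith
  refine ⟨⟨(intervalIntegrable_comp_neg h.1.1).neg, fun t ht => ?_, ?_⟩, by simp [h.2.2], by simp [h.2.1]⟩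
  · simp only [intervalIntegral.integral_neg, neg_neg]
    rw [intervalIntegral.integral_comp_neg, neg_neg, h.2.2,
      h.1.2.1 (-t) ⟨by linarith [ht.2], by linarith [ht.1]⟩, h.2.1]
    have e : (∫ s in -T..(-t), u' s) + ∫ s in (-t)..T, u' s = ∫ s in -T..T, u' s := by
      refine intervalIntegral.integral_add_adjacent_intervals (h.1.1.mono_set ?_)
        (h.1.1.mono_set ?_) <;> rw [uIcc_of_le hTT] <;> refine uIcc_subset_Icc ?_ ?_ <;>
        constructor <;> linarith [ht.1, ht.2]
    have e2 := h.1.2.1 T (right_mem_Icc.2 hTT)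
    rw [h.2.1, h.2.2] at e2
    linarith
  · rw [← intervalIntegrable_iff_integrableOn_Ioo_of_le hTT]
    simpa using intervalIntegrable_comp_neg
      ((intervalIntegrable_iff_integrableOn_Ioo_of_le hTT).2 h.1.2.2)

theorem MemW1p0.intervalIntegrable_anis {p α β a b : ℝ} {u u' : ℝ → ℝ} (hp : 0 < p)
    (ha : 0 ≤ a) (hb : 0 ≤ b) (hαβ : α ≤ β) (h : MemW1p0 p α β u u') :
    IntervalIntegrable (fun t => (a * ppart (u' t) + b * npart (u' t)) ^ p) volume α β := by
  have hpI : IntervalIntegrable (fun t => (a + b) ^ p * |u' t| ^ p) volume α β :=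
    ((intervalIntegrable_iff_integrableOn_Ioo_of_le hαβ).2 h.1.2.2).const_mul _
  have hm : AEStronglyMeasurable (fun t => a * ppart (u' t) + b * npart (u' t))
      (volume.restrict (uIoc α β)) :=
    ((h.1.1.def'.aestronglyMeasurable.sup aestronglyMeasurable_const).const_mul a).add
      ((h.1.1.def'.aestronglyMeasurable.neg.sup aestronglyMeasurable_const).const_mul b)
  refine hpI.mono_fun (hm.aemeasurable.pow_const p).aestronglyMeasurable (ae_of_all _ fun t => ?_)
  have h0 := anis_nonneg ha hb (u' t)
  simp only [Real.norm_eq_abs]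
  rw [← Real.mul_rpow (by positivity) (abs_nonneg _),
    abs_of_nonneg (Real.rpow_nonneg h0 p), abs_of_nonneg (by positivity)]
  refine Real.rpow_le_rpow h0 ?_ hp.le
  nlinarith [mul_le_mul_of_nonneg_left (ppart_le_abs (u' t)) ha,
    mul_le_mul_of_nonneg_left (npart_le_abs (u' t)) hb]

theorem HalfHardy.le_energy_pos {p c T a b : ℝ} {u u' : ℝ → ℝ} (hH : HalfHardy p c)
    (hp : 0 < p) (hc : 0 ≤ c) (hT : 0 < T) (ha : 0 ≤ a) (hb : 0 ≤ b) (hab : 0 < a + b)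
    (h : MemW1p0 p (-T) T u u') :
    c * ((a + b) / (2 * T)) ^ p * ∫ t in -T..T, max (u t) 0 ^ p ≤
      ∫ t in -T..T, (Ioo (-T) T ∩ {t | 0 < u t}).indicator
        (fun t => (a * ppart (u' t) + b * npart (u' t)) ^ p) t := by
  have hTT : -T ≤ T := by linarith
  set S := Ioo (-T) T ∩ {t | 0 < u t}
  have hSm : MeasurableSet S := measurableSet_pos (h.1.continuousOn hTT)
  set Φ : ℝ → ℝ := S.indicator (fun t => (a * ppart (u' t) + b * npart (u' t)) ^ p) with hΦ
  have hF := h.intervalIntegrable_anis hp ha hb hTT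
  have hΦi : IntervalIntegrable Φ volume (-T) T := by
    rw [intervalIntegrable_iff] at hF ⊢
    exact hF.indicator hSm
  have hΦ0 : ∀ t, 0 ≤ Φ t := fun t =>
    indicator_nonneg (fun t _ => Real.rpow_nonneg (anis_nonneg ha hb _) p) t
  have hκ : 0 ≤ (a + b) / (2 * T) := by positivity
  have hL1 : 0 ≤ 2 * T * a / (a + b) := by positivity
  have hL2 : 0 ≤ 2 * T * b / (a + b) := by positivity
  have hL : 2 * T * a / (a + b) + 2 * T * b / (a + b) = 2 * T := by field_simp
  have hκ1 : (a + b) / (2 * T) * (2 * T * a / (a + b)) = a := by field_simp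
  have hκ2 : (a + b) / (2 * T) * (2 * T * b / (a + b)) = b := by field_simp
  set L1 := 2 * T * a / (a + b)
  set L2 := 2 * T * b / (a + b)
  have left := hH.le_integral hp hc h.1 h.2.1 hL1 (by linarith) hκ hκ1 hΦi hΦ0 (by
    intro t ht hut
    rw [hΦ, indicator_of_mem (show t ∈ S from ⟨ht, hut⟩)]
    refine Real.rpow_le_rpow (mul_nonneg ha (ppart_nonneg _)) ?_ hp.le
    linarith [mul_nonneg hb (npart_nonneg (u' t))])
  have right := hH.le_integral (Φ := fun t => Φ (-t)) hp hc (h.reflect hT).1 (h.reflect hT).2.1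
    hL2 (by linarith) hκ hκ2 (intervalIntegrable_comp_neg hΦi)
    (fun t => hΦ0 _) (by
    intro t ht hut
    have htI : -t ∈ S := ⟨⟨by linarith [ht.2], by linarith [ht.1]⟩, hut⟩
    simp only [hΦ]
    rw [indicator_of_mem htI, ppart_neg]
    refine Real.rpow_le_rpow (mul_nonneg hb (npart_nonneg _)) ?_ hp.le
    linarith [mul_nonneg ha (ppart_nonneg (u' (-t)))])
  rw [intervalIntegral.integral_comp_neg (fun t => max (u t) 0 ^ p),
    intervalIntegral.integral_comp_neg, neg_neg,
    show -(-T + L2) = -T + L1 by linarith] at right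
  have hm : -T + L1 ∈ uIcc (-T) T := by
    rw [uIcc_of_le hTT]; constructor <;> linarith
  have hui : IntervalIntegrable (fun t => max (u t) 0 ^ p) volume (-T) T := by
    refine ContinuousOn.intervalIntegrable ?_
    rw [uIcc_of_le hTT]
    exact ((h.1.continuousOn hTT).sup continuousOn_const).rpow_const fun _ _ => Or.inr hp.le
  have split : ∀ {f : ℝ → ℝ}, IntervalIntegrable f volume (-T) T →
      ∫ t in -T..T, f t = (∫ t in -T..(-T + L1), f t) + ∫ t in (-T + L1)..T, f t := fun hf =>
    (intervalIntegral.integral_add_adjacent_intervals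
      (hf.mono_set (uIcc_subset_uIcc left_mem_uIcc hm))
      (hf.mono_set (uIcc_subset_uIcc hm right_mem_uIcc))).symm
  rw [split hui, split hΦi]
  linarith

theorem HalfHardy.le_energy {p c T a b : ℝ} {u u' : ℝ → ℝ} (hH : HalfHardy p c)
    (hp : 0 < p) (hc : 0 ≤ c) (hT : 0 < T) (ha : 0 ≤ a) (hb : 0 ≤ b) (hab : 0 < a + b)
    (h : MemW1p0 p (-T) T u u') :
    c * ((a + b) / (2 * T)) ^ p * ∫ t in -T..T, |u t| ^ p ≤
      ∫ t in -T..T, (a * ppart (u' t) + b * npart (u' t)) ^ p := by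
  have hTT : -T ≤ T := by linarith
  have h1 := hH.le_energy_pos hp hc hT ha hb hab h
  have h2 := hH.le_energy_pos hp hc hT hb ha (by linarith) h.neg
  simp only [ppart_neg, npart_neg] at h2
  rw [add_comm b a] at h2
  have hF := h.intervalIntegrable_anis hp ha hb hTT
  have hcu := h.1.continuousOn hTT
  have hcun : ContinuousOn (fun t => -u t) (Icc (-T) T) := hcu.neg
  have hind : ∀ {v : ℝ → ℝ}, ContinuousOn v (Icc (-T) T) →
      IntervalIntegrable ((Ioo (-T) T ∩ {t | 0 < v t}).indicator
        (fun t => (a * ppart (u' t) + b * npart (u' t)) ^ p)) volume (-T) T := by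
    intro v hv
    rw [intervalIntegrable_iff] at hF ⊢
    exact hF.indicator (measurableSet_pos hv)
  have hpow : ∀ {v : ℝ → ℝ}, ContinuousOn v (Icc (-T) T) →
      IntervalIntegrable (fun t => max (v t) 0 ^ p) volume (-T) T := by
    intro v hv
    refine ContinuousOn.intervalIntegrable ?_
    rw [uIcc_of_le hTT]
    exact (hv.sup continuousOn_const).rpow_const fun _ _ => Or.inr hp.le
  simp only [abs_rpow_eq_add hp]
  rw [intervalIntegral.integral_add (hpow hcu) (hpow hcun), mul_add]
  simp only [add_comm (b * npart _)] at h2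
  refine (add_le_add h1 h2).trans ?_
  rw [← intervalIntegral.integral_add (hind hcu) (hind hcun)]
  refine intervalIntegral.integral_mono_on hTT ((hind hcu).add (hind hcun)) hF fun t _ => ?_
  have h0 : 0 ≤ (a * ppart (u' t) + b * npart (u' t)) ^ p :=
    Real.rpow_nonneg (anis_nonneg ha hb _) p
  simp only [indicator_apply, mem_inter_iff, mem_ofPred_eq]
  split_ifs with h3 h4
  · linarith [h3.2, h4.2]
  all_goals linarith

theorem lamAB_nonneg {p a b α β : ℝ} (ha : 0 ≤ a) (hb : 0 ≤ b) : 0 ≤ lamAB p a b α β := by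
  refine Real.sInf_nonneg ?_
  rintro E ⟨u, u', -, -, rfl⟩
  exact integral_nonneg fun t => Real.rpow_nonneg (anis_nonneg ha hb _) p

theorem lamAB_le {p a b α β : ℝ} {u u' : ℝ → ℝ} (ha : 0 ≤ a) (hb : 0 ≤ b) (hαβ : α ≤ β)
    (h : MemW1p0 p α β u u') (h1 : ∫ t in α..β, |u t| ^ p = 1) :
    lamAB p a b α β ≤ ∫ t in α..β, (a * ppart (u' t) + b * npart (u' t)) ^ p := by
  rw [intervalIntegral.integral_of_le hαβ, integral_Ioc_eq_integral_Ioo] at h1 ⊢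
  refine csInf_le ⟨0, ?_⟩ ⟨u, u', h, h1, rfl⟩
  rintro E ⟨u, u', -, -, rfl⟩
  exact integral_nonneg fun t => Real.rpow_nonneg (anis_nonneg ha hb _) p

theorem HalfHardy.le_lamAB {p c T a b : ℝ} (hH : HalfHardy p c) (hp : 0 < p) (hc : 0 ≤ c)
    (hT : 0 < T) (ha : 0 ≤ a) (hb : 0 ≤ b) (hab : 0 < a + b)
    (hne : ∃ u u', MemW1p0 p (-T) T u u' ∧ (∫ t in Set.Ioo (-T) T, |u t| ^ p) = 1) :
    c * ((a + b) / (2 * T)) ^ p ≤ lamAB p a b (-T) T := by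
  have hTT : -T ≤ T := by linarith
  obtain ⟨u₀, u₀', h₀, h₁⟩ := hne
  refine le_csInf ⟨_, u₀, u₀', h₀, h₁, rfl⟩ ?_
  rintro E ⟨u, u', h, h1, rfl⟩
  have := hH.le_energy hp hc hT ha hb hab h
  rw [intervalIntegral.integral_of_le hTT, integral_Ioc_eq_integral_Ioo, h1, mul_one,
    intervalIntegral.integral_of_le hTT, integral_Ioc_eq_integral_Ioo] at this
  exact this

/-- Gluing at `m` two affine copies of functions on `(0,1)`. -/
theorem intervalIntegrable_glue {F f₁ f₂ : ℝ → ℝ} {T m c₁ c₂ d₁ d₂ : ℝ}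
    (hm₁ : -T < m) (hm₂ : m < T) (hc₁ : c₁ ≠ 0) (hc₂ : c₂ ≠ 0)
    (e₁ : d₁ + c₁ * -T = 0) (e₂ : d₁ + c₁ * m = 1)
    (e₃ : d₂ + c₂ * m = 1) (e₄ : d₂ + c₂ * T = 0)
    (h₁ : ∀ t ≤ m, F t = f₁ (d₁ + c₁ * t)) (h₂ : ∀ t, m < t → F t = f₂ (d₂ + c₂ * t))
    (i₁ : IntervalIntegrable f₁ volume 0 1) (i₂ : IntervalIntegrable f₂ volume 0 1) :
    IntervalIntegrable F volume (-T) m ∧ IntervalIntegrable F volume m T ∧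
      ∫ t in -T..T, F t =
        c₁⁻¹ * (∫ s in (0 : ℝ)..1, f₁ s) - c₂⁻¹ * ∫ s in (0 : ℝ)..1, f₂ s := by
  have q₁ : EqOn (fun t => f₁ (d₁ + c₁ * t)) F (uIoc (-T) m) := fun t ht => by
    rw [uIoc_of_le hm₁.le] at ht
    exact (h₁ t ht.2).symm
  have q₂ : EqOn (fun t => f₂ (d₂ + c₂ * t)) F (uIoc m T) := fun t ht => by
    rw [uIoc_of_le hm₂.le] at ht
    exact (h₂ t ht.1).symm
  have j₁ : IntervalIntegrable F volume (-T) m :=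
    (intervalIntegrable_comp_affine hc₁ (by rwa [e₁, e₂])).congr q₁
  have j₂ : IntervalIntegrable F volume m T :=
    (intervalIntegrable_comp_affine hc₂ (by rw [e₃, e₄]; exact i₂.symm)).congr q₂
  refine ⟨j₁, j₂, ?_⟩
  rw [← intervalIntegral.integral_add_adjacent_intervals j₁ j₂,
    ← intervalIntegral.integral_congr_ae (ae_of_all _ fun t ht => q₁ ht),
    ← intervalIntegral.integral_congr_ae (ae_of_all _ fun t ht => q₂ ht),
    intervalIntegral.integral_comp_add_mul _ hc₁, intervalIntegral.integral_comp_add_mul _ hc₂,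
    e₁, e₂, e₃, e₄, intervalIntegral.integral_symm 0 1, smul_eq_mul, smul_eq_mul]
  ring

theorem memW1p0_glue {p T m c₁ c₂ d₁ d₂ k : ℝ} {g : ℝ → ℝ}
    (hm₁ : -T < m) (hm₂ : m < T) (hc₁ : c₁ ≠ 0) (hc₂ : c₂ ≠ 0)
    (e₁ : d₁ + c₁ * -T = 0) (e₂ : d₁ + c₁ * m = 1)
    (e₃ : d₂ + c₂ * m = 1) (e₄ : d₂ + c₂ * T = 0)
    (hg0 : ∀ t, 0 ≤ g t) (hg : IntervalIntegrable g volume 0 1)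
    (hgp : IntervalIntegrable (fun t => g t ^ p) volume 0 1) :
    MemW1p0 p (-T) T
      (fun t => if t ≤ m then k * ∫ s in (0 : ℝ)..(d₁ + c₁ * t), g s
        else k * ∫ s in (0 : ℝ)..(d₂ + c₂ * t), g s)
      (fun t => if t ≤ m then k * c₁ * g (d₁ + c₁ * t) else k * c₂ * g (d₂ + c₂ * t)) := by
  have hTT : -T ≤ T := by linarith
  set u' : ℝ → ℝ := fun t =>
    if t ≤ m then k * c₁ * g (d₁ + c₁ * t) else k * c₂ * g (d₂ + c₂ * t) with hu'
  have hl : ∀ t ≤ m, u' t = k * c₁ * g (d₁ + c₁ * t) := fun t ht => if_pos ht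
  have hr : ∀ t, m < t → u' t = k * c₂ * g (d₂ + c₂ * t) := fun t ht => if_neg ht.not_ge
  obtain ⟨j₁, j₂, -⟩ := intervalIntegrable_glue hm₁ hm₂ hc₁ hc₂ e₁ e₂ e₃ e₄
    (f₁ := fun s => k * c₁ * g s) (f₂ := fun s => k * c₂ * g s) hl hr
    (hg.const_mul _) (hg.const_mul _)
  have habs : ∀ c s, |k * c * g s| ^ p = |k * c| ^ p * g s ^ p := fun c s => by
    rw [abs_mul, abs_of_nonneg (hg0 s), Real.mul_rpow (abs_nonneg _) (hg0 s)]
  obtain ⟨l₁, l₂, -⟩ := intervalIntegrable_glue (F := fun t => |u' t| ^ p)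
    hm₁ hm₂ hc₁ hc₂ e₁ e₂ e₃ e₄
    (f₁ := fun s => |k * c₁| ^ p * g s ^ p) (f₂ := fun s => |k * c₂| ^ p * g s ^ p)
    (fun t ht => by rw [hl t ht, habs]) (fun t ht => by rw [hr t ht, habs])
    (hgp.const_mul _) (hgp.const_mul _)
  have hleft : ∀ t ∈ Icc (-T) m, ∫ s in -T..t, u' s = k * ∫ s in (0 : ℝ)..(d₁ + c₁ * t), g s := by
    intro t ht
    rw [intervalIntegral.integral_congr_ae (g := fun s => k * c₁ * g (d₁ + c₁ * s))
      (ae_of_all _ fun s hs => by rw [uIoc_of_le ht.1] at hs; exact hl s (hs.2.trans ht.2)),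
      intervalIntegral.integral_const_mul, intervalIntegral.integral_comp_add_mul _ hc₁, e₁,
      smul_eq_mul]
    field_simp
  refine ⟨⟨j₁.trans j₂, fun t ht => ?_, ?_⟩, ?_, ?_⟩
  · simp only [if_pos hm₁.le, e₁, intervalIntegral.integral_same, mul_zero, zero_add]
    split_ifs with htm
    · exact (hleft t ⟨ht.1, htm⟩).symm
    · push Not at htm
      have j₃ : IntervalIntegrable u' volume m t := by
        refine j₂.mono_set ?_
        rw [uIcc_of_le hm₂.le, uIcc_of_le htm.le]
        exact Icc_subset_Icc_right ht.2
      have hright : ∫ s in m..t, u' s = k * ∫ s in (1 : ℝ)..(d₂ + c₂ * t), g s := by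
        rw [intervalIntegral.integral_congr_ae (g := fun s => k * c₂ * g (d₂ + c₂ * s))
          (ae_of_all _ fun s hs => by rw [uIoc_of_le htm.le] at hs; exact hr s hs.1),
          intervalIntegral.integral_const_mul, intervalIntegral.integral_comp_add_mul _ hc₂, e₃,
          smul_eq_mul]
        field_simp
      have hmem : d₂ + c₂ * t ∈ uIcc (0 : ℝ) 1 := by
        have h1 : c₂ * (T - m) = -1 := by linarith
        have h2 : c₂ < 0 := by
          by_contra hcon
          have := mul_nonneg (not_lt.1 hcon) (sub_pos.2 hm₂).le
          linarith
        rw [uIcc_of_le zero_le_one]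
        constructor
        · nlinarith [ht.2]
        · nlinarith
      rw [← intervalIntegral.integral_add_adjacent_intervals j₁ j₃, hleft m ⟨hm₁.le, le_rfl⟩, e₂,
        hright, ← mul_add, intervalIntegral.integral_add_adjacent_intervals hg
        (hg.mono_set (uIcc_subset_uIcc right_mem_uIcc hmem))]
  · exact (intervalIntegrable_iff_integrableOn_Ioo_of_le hTT).1 (l₁.trans l₂)
  · simp only [if_pos hm₁.le, e₁, intervalIntegral.integral_same, mul_zero]
  · simp only [if_neg hm₂.not_ge, e₄, intervalIntegral.integral_same, mul_zero]

theorem halfHardy_of_lamAB {p T a b : ℝ} (hp : 0 < p) (hT : 0 < T) (ha : 0 < a) (hb : 0 < b) :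
    HalfHardy p (lamAB p a b (-T) T / ((a + b) / (2 * T)) ^ p) := by
  intro g hg0 hg hgp
  set V : ℝ → ℝ := fun s => ∫ r in (0 : ℝ)..s, g r with hV
  have hV0 : ∀ s ∈ Icc (0 : ℝ) 1, 0 ≤ V s := fun s hs =>
    intervalIntegral.integral_nonneg hs.1 fun r _ => hg0 r
  have hVc : ContinuousOn V (uIcc 0 1) :=
    intervalIntegral.continuousOn_primitive_interval' hg left_mem_uIcc
  change _ * (∫ s in (0 : ℝ)..1, V s ^ p) ≤ _
  set M := ∫ s in (0 : ℝ)..1, V s ^ p with hM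
  set N := ∫ s in (0 : ℝ)..1, g s ^ p with hN
  have hM0 : 0 ≤ M := intervalIntegral.integral_nonneg zero_le_one fun s hs =>
    Real.rpow_nonneg (hV0 s hs) p
  have hN0 : 0 ≤ N := intervalIntegral.integral_nonneg zero_le_one fun s _ =>
    Real.rpow_nonneg (hg0 s) p
  rcases hM0.eq_or_lt with hMz | hMpos
  · rw [← hMz, mul_zero]; exact hN0
  have hTT : -T ≤ T := by linarith
  have hab : 0 < a + b := by linarith
  set κ := (a + b) / (2 * T) with hκ
  have hκ0 : 0 < κ := by positivity
  have hκp : 0 < κ ^ p := Real.rpow_pos_of_pos hκ0 p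
  set k := ((2 * T * M)⁻¹) ^ p⁻¹ with hk
  have hk0 : 0 ≤ k := by positivity
  have hkp : k ^ p * (2 * T * M) = 1 := by
    rw [hk, Real.rpow_inv_rpow (by positivity) hp.ne']
    field_simp
  set c₁ := κ / a with hc₁
  set c₂ := -(κ / b) with hc₂
  set m := -T + a / κ with hm
  have hsum : a / κ + b / κ = 2 * T := by rw [hκ]; field_simp
  have hm₁ : -T < m := by have : 0 < a / κ := by positivity
                          linarith
  have hm₂ : m < T := by have : 0 < b / κ := by positivity
                         linarith
  have hc₁0 : 0 < c₁ := by positivity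
  have hc₂0 : 0 < κ / b := by positivity
  have hc₂' : c₂ ≠ 0 := by rw [hc₂]; exact neg_ne_zero.2 hc₂0.ne'
  have e₁ : c₁ * T + c₁ * -T = 0 := by ring
  have e₂ : c₁ * T + c₁ * m = 1 := by rw [hc₁, hm]; field_simp; ring
  have e₄ : κ / b * T + c₂ * T = 0 := by rw [hc₂]; ring
  have e₃ : κ / b * T + c₂ * m = 1 := by
    have : m = T - b / κ := by linarith
    rw [hc₂, this]; field_simp; ring
  have hmem := memW1p0_glue (k := k) hm₁ hm₂ hc₁0.ne' hc₂' e₁ e₂ e₃ e₄ hg0 hg hgp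
  set u : ℝ → ℝ := fun t => if t ≤ m then k * V (c₁ * T + c₁ * t)
    else k * V (κ / b * T + c₂ * t) with hu
  set u' : ℝ → ℝ := fun t => if t ≤ m then k * c₁ * g (c₁ * T + c₁ * t)
    else k * c₂ * g (κ / b * T + c₂ * t) with hu'
  have hci : c₁⁻¹ - c₂⁻¹ = 2 * T := by
    rw [← hsum, hc₁, hc₂, inv_neg, inv_div, inv_div]; ring
  have hVi : IntervalIntegrable (fun s => |k * V s| ^ p) volume 0 1 :=
    ((continuousOn_const.mul hVc).abs.rpow_const fun _ _ => Or.inr hp.le).intervalIntegrable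
  have hmass := (intervalIntegrable_glue (F := fun t => |u t| ^ p)
    hm₁ hm₂ hc₁0.ne' hc₂' e₁ e₂ e₃ e₄ (f₁ := fun s => |k * V s| ^ p)
    (f₂ := fun s => |k * V s| ^ p)
    (fun t ht => by rw [hu]; simp only [if_pos ht])
    (fun t ht => by rw [hu]; simp only [if_neg ht.not_ge]) hVi hVi).2.2
  have hVM : ∫ s in (0 : ℝ)..1, |k * V s| ^ p = k ^ p * M := by
    rw [hM, ← intervalIntegral.integral_const_mul]
    refine intervalIntegral.integral_congr fun s hs => ?_
    rw [uIcc_of_le zero_le_one] at hs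
    rw [abs_of_nonneg (mul_nonneg hk0 (hV0 s hs)), Real.mul_rpow hk0 (hV0 s hs)]
  rw [hVM, ← sub_mul, hci, show 2 * T * (k ^ p * M) = k ^ p * (2 * T * M) by ring, hkp] at hmass
  have hFi : IntervalIntegrable (fun s => (k * κ) ^ p * g s ^ p) volume 0 1 := hgp.const_mul _
  have hen := (intervalIntegrable_glue
    (F := fun t => (a * ppart (u' t) + b * npart (u' t)) ^ p)
    hm₁ hm₂ hc₁0.ne' hc₂' e₁ e₂ e₃ e₄ (f₁ := fun s => (k * κ) ^ p * g s ^ p)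
    (f₂ := fun s => (k * κ) ^ p * g s ^ p)
    (fun t ht => by
      have h0 : 0 ≤ k * c₁ * g (c₁ * T + c₁ * t) := mul_nonneg (by positivity) (hg0 _)
      rw [hu']
      simp only [if_pos ht]
      rw [ppart, npart, max_eq_left h0, max_eq_right (neg_nonpos.2 h0),
        ← Real.mul_rpow (by positivity) (hg0 _)]
      congr 1
      rw [hc₁]; field_simp; ring)
    (fun t ht => by
      have h0 : k * c₂ * g (κ / b * T + c₂ * t) ≤ 0 := by
        have : 0 ≤ k * (κ / b) * g (κ / b * T + c₂ * t) := mul_nonneg (by positivity) (hg0 _)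
        rw [hc₂] at this ⊢
        linarith
      rw [hu']
      simp only [if_neg ht.not_ge]
      rw [ppart, npart, max_eq_right h0, max_eq_left (neg_nonneg.2 h0),
        ← Real.mul_rpow (by positivity) (hg0 _)]
      congr 1
      generalize g (κ / b * T + c₂ * t) = y
      rw [hc₂]; field_simp; ring) hFi hFi).2.2
  rw [intervalIntegral.integral_const_mul, ← sub_mul, hci, ← hN, Real.mul_rpow hk0 hκ0.le] at hen
  have hle := lamAB_le ha.le hb.le hTT hmem hmass
  rw [show (∫ t in -T..T, (a * ppart (u' t) + b * npart (u' t)) ^ p)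
    = 2 * T * (k ^ p * κ ^ p * N) from hen] at hle
  rw [div_mul_eq_mul_div, div_le_iff₀ hκp]
  calc lamAB p a b (-T) T * M ≤ 2 * T * (k ^ p * κ ^ p * N) * M := by gcongr
    _ = k ^ p * (2 * T * M) * (N * κ ^ p) := by ring
    _ = N * κ ^ p := by rw [hkp, one_mul]

theorem lamAB_one_one (p α β : ℝ) : lamAB p 1 1 α β = lam1 p α β := by
  simp only [lamAB, lam1, one_mul, ppart_add_npart]

theorem lamAB_mono_right {p T a b b' : ℝ} (hp : 0 < p) (hT : 0 < T) (ha : 0 ≤ a) (hb : 0 ≤ b)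
    (hbb : b ≤ b')
    (hne : ∃ u u', MemW1p0 p (-T) T u u' ∧ (∫ t in Set.Ioo (-T) T, |u t| ^ p) = 1) :
    lamAB p a b (-T) T ≤ lamAB p a b' (-T) T := by
  have hTT : -T ≤ T := by linarith
  obtain ⟨u₀, u₀', h₀, h₁⟩ := hne
  refine le_csInf ⟨_, u₀, u₀', h₀, h₁, rfl⟩ ?_
  rintro E ⟨u, u', h, h1, rfl⟩
  have h2 : ∫ t in -T..T, |u t| ^ p = 1 := by
    rwa [intervalIntegral.integral_of_le hTT, integral_Ioc_eq_integral_Ioo]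
  refine (lamAB_le ha hb hTT h h2).trans ?_
  rw [← integral_Ioc_eq_integral_Ioo, ← intervalIntegral.integral_of_le hTT]
  refine intervalIntegral.integral_mono_on hTT (h.intervalIntegrable_anis hp ha hb hTT)
    (h.intervalIntegrable_anis hp ha (hb.trans hbb) hTT) fun t _ =>
    Real.rpow_le_rpow (anis_nonneg ha hb _) ?_ hp.le
  have := mul_le_mul_of_nonneg_right hbb (npart_nonneg (u' t))
  linarith

theorem lamAB_le_mul_lam1 {p T a b : ℝ} (hp : 0 < p) (hT : 0 < T) (ha : 0 < a) (hb : 0 < b)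
    (hne : ∃ u u', MemW1p0 p (-T) T u u' ∧ (∫ t in Set.Ioo (-T) T, |u t| ^ p) = 1) :
    lamAB p a b (-T) T ≤ ((a + b) / 2) ^ p * lam1 p (-T) T := by
  have h := (halfHardy_of_lamAB hp hT ha hb).le_lamAB hp
    (div_nonneg (lamAB_nonneg ha.le hb.le) (by positivity)) hT
    zero_le_one zero_le_one (by norm_num) hne
  rw [lamAB_one_one, show ((1 : ℝ) + 1) / (2 * T) = T⁻¹ by field_simp; norm_num,
    show (a + b) / (2 * T) = (a + b) / 2 * T⁻¹ by field_simp,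
    Real.mul_rpow (by positivity) (by positivity)] at h
  have h1 : 0 < ((a + b) / 2) ^ p := by positivity
  have h2 : 0 < T⁻¹ ^ p := by positivity
  rw [div_mul_eq_mul_div, mul_div_mul_right _ _ h2.ne', div_le_iff₀ h1] at h
  linarith

theorem mul_lam1_le_lamAB {p T a b : ℝ} (hp : 0 < p) (hT : 0 < T) (ha : 0 < a) (hb : 0 ≤ b)
    (hne : ∃ u u', MemW1p0 p (-T) T u u' ∧ (∫ t in Set.Ioo (-T) T, |u t| ^ p) = 1) :
    ((a + b) / 2) ^ p * lam1 p (-T) T ≤ lamAB p a b (-T) T := by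
  have h := (halfHardy_of_lamAB hp hT zero_lt_one zero_lt_one).le_lamAB hp
    (div_nonneg (lamAB_nonneg zero_le_one zero_le_one) (by positivity)) hT
    ha.le hb (by linarith) hne
  rw [lamAB_one_one, show ((1 : ℝ) + 1) / (2 * T) = T⁻¹ by field_simp; norm_num,
    show (a + b) / (2 * T) = (a + b) / 2 * T⁻¹ by field_simp,
    Real.mul_rpow (by positivity) (by positivity)] at h
  have h2 : 0 < T⁻¹ ^ p := by positivity
  rwa [div_mul_eq_mul_div, mul_div_assoc, mul_div_cancel_right₀ _ h2.ne', mul_comm] at h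

theorem lamAB_eq (p T a b : ℝ) (hp : 1 < p) (hT : 0 < T) (ha : 0 < a) (hb : 0 ≤ b) :
    lamAB p a b (-T) T = ((a + b) / 2) ^ p * lam1 p (-T) T := by
  have hp0 : 0 < p := by linarith
  by_cases hne : ∃ u u', MemW1p0 p (-T) T u u' ∧ (∫ t in Set.Ioo (-T) T, |u t| ^ p) = 1
  · refine le_antisymm ?_ (mul_lam1_le_lamAB hp0 hT ha hb hne)
    have hcont : Continuous fun b' : ℝ => ((a + b') / 2) ^ p * lam1 p (-T) T :=
      ((by fun_prop : Continuous fun b' : ℝ => (a + b') / 2).rpow_const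
        fun _ => Or.inr hp0.le).mul continuous_const
    refine ge_of_tendsto ((hcont.tendsto b).mono_left nhdsWithin_le_nhds : Tendsto _ (𝓝[>] b) _) ?_
    filter_upwards [self_mem_nhdsWithin] with b' hb'
    exact (lamAB_mono_right hp0 hT ha.le hb (le_of_lt hb') hne).trans
      (lamAB_le_mul_lam1 hp0 hT ha (hb.trans_lt hb') hne)
  · have hempty : ∀ H : ℝ → ℝ, lamH1 p H (-T) T = 0 := by
      intro H
      have : { E | ∃ u u', MemW1p0 p (-T) T u u' ∧ (∫ t in Set.Ioo (-T) T, |u t| ^ p) = 1 ∧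
          E = ∫ t in Set.Ioo (-T) T, H (u' t) ^ p } = ∅ := by
        refine eq_empty_of_forall_notMem ?_
        rintro E ⟨u, u', h, h1, -⟩
        exact hne ⟨u, u', h, h1⟩
      rw [lamH1, this, Real.sInf_empty]
    rw [lamAB, lam1, hempty, hempty, mul_zero]

end
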